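/- There is no 2×2 integer matrix C with C² = I and det C = −1 such that C maps the column vector (3, 5) to the column vector (1, 0). (Algebraic form of the statement that no real structure on the torus exchanging the two singular fibers can send the vanishing cycle u = 3a+5b to the vanishing cycle v = a, since then the primitive forms of u+v and u−v would be eigenvectors of eigenvalue +1 and −1 with intersection number exceeding 2.) -/

import Mathlib

open Matrix

theorem stmt_11 :
    ¬ ∃ C : Matrix (Fin 2) (Fin 2) ℤ,
        C ^ 2 = 1 ∧ C.det = -1 ∧ C *ᵥ ![3, 5] = ![1, 0] := by
  rintro ⟨C, h2, -, h⟩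
  have h1 : C *ᵥ ![1, 0] = ![3, 5] := by
    rw [← h, Matrix.mulVec_mulVec, ← pow_two, h2, Matrix.one_mulVec]
  have e1 := congrFun h1 0
  have e2 := congrFun h 0
  simp [Matrix.mulVec, dotProduct, Fin.sum_univ_two] at e1 e2
  omega
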